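/- arXiv:2403.17968 — 3 statements merged into one kernel-verified Lean document; each statement's English description precedes it below -/
import Mathlib

section
/- (Property 1) Assume the Četaev condition holds for the virtual displacement δq ∈ ℝⁿ. Then for each s = 1, …, N the displacement δr_s := Σ_{j=1}^{n} (∂r_s/∂q_j) δq_j satisfies δr_s = Σ_{r=1}^{m} (∂ṙ_s/∂q̇_r) δq_r, where ṙ_s(q, q̇₁, …, q̇_m, t) = Σ_{r=1}^{m} (∂r_s/∂q_r) q̇_r + Σ_{ν=1}^{k} (∂r_s/∂q_{m+ν}) α_ν + ∂r_s/∂t is the velocity with the dependent velocities replaced by the functions α_ν, and ∂ṙ_s/∂q̇_r denotes the partial derivative of this restricted function with respect to the independent velocity q̇_r. -/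
/-- Partial derivative of `f : (ι → ℝ) → E` at `x` in the `j`-th coordinate direction. -/
noncomputable def pd {ι : Type*} [Fintype ι] [DecidableEq ι] {E : Type*}
    [NormedAddCommGroup E] [NormedSpace ℝ E]
    (f : (ι → ℝ) → E) (x : ι → ℝ) (j : ι) : E :=
  fderiv ℝ f x (Pi.single j 1)

theorem fderiv_apply_eq_sum_pd {ι : Type*} [Fintype ι] [DecidableEq ι] {E : Type*}
    [NormedAddCommGroup E] [NormedSpace ℝ E] (f : (ι → ℝ) → E) (x v : ι → ℝ) :
    fderiv ℝ f x v = ∑ j, v j • pd f x j := by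
  conv_lhs => rw [pi_eq_sum_univ' v]
  simp only [map_sum, map_smul, pd]

theorem hasFDerivAt_append {m k : ℕ} {a : Fin k → (Fin m → ℝ) → ℝ}
    {A : Fin k → (Fin m → ℝ) →L[ℝ] ℝ} {u : Fin m → ℝ} (h : ∀ ν, HasFDerivAt (a ν) (A ν) u) :
    HasFDerivAt (fun u' => (Fin.append u' fun ν => a ν u' : Fin (m + k) → ℝ))
      (ContinuousLinearMap.pi
        (Fin.append (fun i => ContinuousLinearMap.proj (R := ℝ) i) A)) u := by
  rw [hasFDerivAt_pi]
  intro j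
  refine Fin.addCases (fun i => ?_) (fun ν => ?_) j
  · simpa only [Fin.append_left] using hasFDerivAt_apply i u
  · simpa only [Fin.append_right] using h ν

/-- A vector annihilated by the derivative of implicit constraints is tangent to the graph of
their solution. -/
theorem eq_fderiv_apply_of_sum_pd_eq_zero {m k : ℕ} {G : Fin k → (Fin (m + k) → ℝ) → ℝ}
    {a : Fin k → (Fin m → ℝ) → ℝ} {u : Fin m → ℝ} {δ : Fin (m + k) → ℝ}
    (hG : ∀ ν, DifferentiableAt ℝ (G ν) (Fin.append u fun σ => a σ u))
    (ha : ∀ ν, DifferentiableAt ℝ (a ν) u)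
    (hdet : (Matrix.of fun ν s : Fin k =>
      pd (G ν) (Fin.append u fun σ => a σ u) (Fin.natAdd m s)).det ≠ 0)
    (hsolve : ∀ ν u', G ν (Fin.append u' fun σ => a σ u') = 0)
    (hδ : ∀ ν, ∑ j, pd (G ν) (Fin.append u fun σ => a σ u) j * δ j = 0) (ν : Fin k) :
    δ (Fin.natAdd m ν) = fderiv ℝ (a ν) u fun r => δ (Fin.castAdd k r) := by
  set w : Fin m → ℝ := fun r => δ (Fin.castAdd k r)
  have hV := hasFDerivAt_append fun ν => (ha ν).hasFDerivAt
  have hzero : (Matrix.of fun ν s : Fin k =>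
      pd (G ν) (Fin.append u fun σ => a σ u) (Fin.natAdd m s)).mulVec
        (fun ν => δ (Fin.natAdd m ν) - fderiv ℝ (a ν) u w) = 0 := by
    ext μ
    have hcomp := (hG μ).hasFDerivAt.comp u hV
    have hconst : (G μ ∘ fun u' => (Fin.append u' fun ν => a ν u' : Fin (m + k) → ℝ))
        = fun _ => 0 := funext (hsolve μ)
    rw [hconst] at hcomp
    have h := congrArg (fun L => L w) (hcomp.unique (hasFDerivAt_const 0 u))
    have hc := hδ μ
    simp only [ContinuousLinearMap.comp_apply, fderiv_apply_eq_sum_pd (G μ), Fin.sum_univ_add,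
      ContinuousLinearMap.pi_apply, Fin.append_left, Fin.append_right,
      ContinuousLinearMap.proj_apply, zero_apply, smul_eq_mul] at h
    rw [Fin.sum_univ_add] at hc
    simp only [Matrix.mulVec, dotProduct, Matrix.of_apply, mul_sub, Finset.sum_sub_distrib,
      Pi.zero_apply]
    simp only [mul_comm (pd _ _ _)] at hc ⊢
    linarith
  exact sub_eq_zero.mp (congrFun (Matrix.eq_zero_of_mulVec_eq_zero hdet hzero) ν)

/-- Property 1: if the Četaev condition holds for `δq`, then for each
point `s` the virtual displacement `δr_s = Σ_j (∂r_s/∂q_j) δq_j` equals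
`Σ_{r=1}^m (∂ṙ_s/∂q̇_r) δq_r`, where `ṙ_s` is the velocity with the dependent
velocities replaced by the functions `α_ν`. -/
theorem virtual_displacement_via_restricted_velocity (m k N : ℕ) (hm : 0 < m) (hk : 0 < k)
    (g : Fin k → (Fin (m + k) → ℝ) → (Fin (m + k) → ℝ) → ℝ → ℝ)
    (hg : ∀ ν, ContDiff ℝ 1
      (fun p : ((Fin (m + k) → ℝ) × (Fin (m + k) → ℝ) × ℝ) => g ν p.1 p.2.1 p.2.2))
    (α : Fin k → (Fin (m + k) → ℝ) → (Fin m → ℝ) → ℝ → ℝ)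
    (hα : ∀ ν, ContDiff ℝ 1
      (fun p : ((Fin (m + k) → ℝ) × (Fin m → ℝ) × ℝ) => α ν p.1 p.2.1 p.2.2))
    (hdet : ∀ (q : Fin (m + k) → ℝ) (u : Fin m → ℝ) (t : ℝ),
      (Matrix.of fun ν s : Fin k =>
        pd (fun v => g ν q v t) (Fin.append u fun σ => α σ q u t) (Fin.natAdd m s)).det ≠ 0)
    (hsolve : ∀ (ν : Fin k) (q : Fin (m + k) → ℝ) (u : Fin m → ℝ) (t : ℝ),
      g ν q (Fin.append u fun σ => α σ q u t) t = 0)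
    (rpos : Fin N → (Fin (m + k) → ℝ) → ℝ → (Fin 3 → ℝ))
    (hr : ∀ s, ContDiff ℝ 1 (fun p : ((Fin (m + k) → ℝ) × ℝ) => rpos s p.1 p.2))
    (q : Fin (m + k) → ℝ) (u : Fin m → ℝ) (t : ℝ) (δq : Fin (m + k) → ℝ)
    (hcet : ∀ ν : Fin k,
      ∑ j, pd (fun v => g ν q v t) (Fin.append u fun σ => α σ q u t) j * δq j = 0) :
    ∀ s : Fin N,
      (∑ j, δq j • pd (fun q' => rpos s q' t) q j)
        = ∑ r : Fin m, δq (Fin.castAdd k r) •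
            pd (fun u' : Fin m → ℝ =>
                (∑ r' : Fin m, u' r' • pd (fun q' => rpos s q' t) q (Fin.castAdd k r'))
                  + (∑ ν : Fin k, α ν q u' t • pd (fun q' => rpos s q' t) q (Fin.natAdd m ν))
                  + deriv (fun t' => rpos s q t') t)
              u r := by
  intro s
  have ha : ∀ ν, DifferentiableAt ℝ (fun u' => α ν q u' t) u := fun ν =>
    ((hα ν).differentiable one_ne_zero).comp
      (f := fun u' : Fin m → ℝ => (q, u', t)) (by fun_prop) u
  have hG : ∀ ν, DifferentiableAt ℝ (fun v => g ν q v t)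
      (Fin.append u fun σ => α σ q u t) := fun ν =>
    ((hg ν).differentiable one_ne_zero).comp
      (f := fun v : Fin (m + k) → ℝ => (q, v, t)) (by fun_prop) _
  have hδ := eq_fderiv_apply_of_sum_pd_eq_zero (a := fun ν u' => α ν q u' t) hG ha
    (hdet q u t) (fun ν u' => hsolve ν q u' t) hcet
  have hF := ((HasFDerivAt.fun_sum (u := Finset.univ) fun r _ =>
      (hasFDerivAt_apply (𝕜 := ℝ) r u).smul_const
        (pd (fun q' => rpos s q' t) q (Fin.castAdd k r))).add
    (HasFDerivAt.fun_sum (u := Finset.univ) fun ν _ => (ha ν).hasFDerivAt.smul_const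
        (pd (fun q' => rpos s q' t) q (Fin.natAdd m ν)))).add_const
      (deriv (fun t' => rpos s q t') t)
  rw [← fderiv_apply_eq_sum_pd _ u fun r => δq (Fin.castAdd k r), Fin.sum_univ_add]
  simp only [hδ]
  refine Eq.trans ?_ (congrArg (fun L => L fun r => δq (Fin.castAdd k r)) hF.fderiv).symm
  simp
end

section
/- Assume ᾱ_ν = α_ν for every ν = 1, …, k (where ᾱ_ν := Σ_{r=1}^{m} (∂α_ν/∂q̇_r) q̇_r). Then every generalized constraint force of multiplier form R^{(j)} = Σ_{ν=1}^{k} λ_ν (∂g_ν/∂q̇_j) (with arbitrary real multipliers λ_ν and derivatives evaluated at the constrained velocity) performs zero power along any velocity compatible with the constraints: Σ_{j=1}^{n} R^{(j)} q̇_j = 0, where q̇_{m+ν} = α_ν. -/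
/-- The directional derivative along `v` is the sum of the partial derivatives weighted by the
coordinates of `v`. -/
theorem sum_pd_mul {ι : Type*} [Fintype ι] [DecidableEq ι] (f : (ι → ℝ) → ℝ) (x v : ι → ℝ) :
    ∑ j, pd f x j * v j = fderiv ℝ f x v := by
  conv_rhs => rw [pi_eq_sum_univ' v, map_sum]
  refine Finset.sum_congr rfl fun j _ => ?_
  rw [map_smul, smul_eq_mul, mul_comm, pd]

/-- If `f` vanishes on the graph `u ↦ (u, a u)` and `a` satisfies Euler's relation at `u`, then the
derivative of `f` at `(u, a u)` annihilates `(u, a u)`. -/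
theorem fderiv_append_self_eq_zero {m k : ℕ} {f : (Fin (m + k) → ℝ) → ℝ}
    {a : Fin k → (Fin m → ℝ) → ℝ} {u : Fin m → ℝ}
    (hf : DifferentiableAt ℝ f (Fin.append u fun σ => a σ u))
    (ha : ∀ σ, DifferentiableAt ℝ (a σ) u)
    (hzero : ∀ w, f (Fin.append w fun σ => a σ w) = 0)
    (heuler : ∀ σ, fderiv ℝ (a σ) u u = a σ u) :
    fderiv ℝ f (Fin.append u fun σ => a σ u) (Fin.append u fun σ => a σ u) = 0 := by
  set L : (Fin m → ℝ) →L[ℝ] (Fin (m + k) → ℝ) :=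
    ContinuousLinearMap.pi
      (Fin.append (fun i => ContinuousLinearMap.proj i) fun σ => fderiv ℝ (a σ) u) with hL
  have hgraph : HasFDerivAt (fun w => Fin.append w fun σ => a σ w) L u := by
    rw [hasFDerivAt_pi']
    intro j
    refine Fin.addCases (fun i => ?_) (fun σ => ?_) j
    · have h : (ContinuousLinearMap.proj (Fin.castAdd k i)).comp L =
          (ContinuousLinearMap.proj i : (Fin m → ℝ) →L[ℝ] ℝ) := by
        ext w
        simp [hL]
      rw [h]
      simpa only [Fin.append_left] using hasFDerivAt_apply i u
    · have h : (ContinuousLinearMap.proj (Fin.natAdd m σ)).comp L = fderiv ℝ (a σ) u := by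
        ext w
        simp [hL]
      rw [h]
      simpa only [Fin.append_right] using (ha σ).hasFDerivAt
  have hLu : L u = Fin.append u fun σ => a σ u := by
    ext j
    refine Fin.addCases (fun i => ?_) (fun σ => ?_) j
    · simp [hL]
    · simp [hL, heuler]
  have hcomp := hf.hasFDerivAt.comp u hgraph
  have hconst : (f ∘ fun w => Fin.append w fun σ => a σ w) = fun _ => 0 := funext hzero
  rw [hconst] at hcomp
  have h := DFunLike.congr_fun (hcomp.unique (hasFDerivAt_const 0 u)) u
  rw [ContinuousLinearMap.comp_apply, hLu] at h
  simpa using h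

/-- if `ᾱ_ν = α_ν` for every `ν`, then every generalized constraint force
of multiplier form `R^{(j)} = Σ_ν λ_ν (∂g_ν/∂q̇_j)` (derivatives evaluated at the
constrained velocity) performs zero power along any velocity compatible with the
constraints: `Σ_j R^{(j)} q̇_j = 0` with `q̇_{m+ν} = α_ν`. -/
theorem multiplier_constraint_force_zero_power (m k : ℕ) (hm : 0 < m) (hk : 0 < k)
    (g : Fin k → (Fin (m + k) → ℝ) → (Fin (m + k) → ℝ) → ℝ → ℝ)
    (hg : ∀ ν, ContDiff ℝ 1
      (fun p : ((Fin (m + k) → ℝ) × (Fin (m + k) → ℝ) × ℝ) => g ν p.1 p.2.1 p.2.2))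
    (α : Fin k → (Fin (m + k) → ℝ) → (Fin m → ℝ) → ℝ → ℝ)
    (hα : ∀ ν, ContDiff ℝ 1
      (fun p : ((Fin (m + k) → ℝ) × (Fin m → ℝ) × ℝ) => α ν p.1 p.2.1 p.2.2))
    (hdet : ∀ (q : Fin (m + k) → ℝ) (u : Fin m → ℝ) (t : ℝ),
      (Matrix.of fun ν s : Fin k =>
        pd (fun v => g ν q v t) (Fin.append u fun σ => α σ q u t) (Fin.natAdd m s)).det ≠ 0)
    (hsolve : ∀ (ν : Fin k) (q : Fin (m + k) → ℝ) (u : Fin m → ℝ) (t : ℝ),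
      g ν q (Fin.append u fun σ => α σ q u t) t = 0)
    (hbar : ∀ (ν : Fin k) (q : Fin (m + k) → ℝ) (u : Fin m → ℝ) (t : ℝ),
      ∑ r : Fin m, pd (fun u' => α ν q u' t) u r * u r = α ν q u t) :
    ∀ (lam : Fin k → ℝ) (q : Fin (m + k) → ℝ) (u : Fin m → ℝ) (t : ℝ),
      ∑ j, (∑ ν : Fin k,
          lam ν * pd (fun v => g ν q v t) (Fin.append u fun σ => α σ q u t) j)
            * (Fin.append u fun σ => α σ q u t) j = 0 := by
  intro lam q u t
  have hpower : ∀ ν, ∑ j, pd (fun v => g ν q v t) (Fin.append u fun σ => α σ q u t) j *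
      (Fin.append u fun σ => α σ q u t) j = 0 := by
    intro ν
    rw [sum_pd_mul]
    refine fderiv_append_self_eq_zero (f := fun v => g ν q v t) (a := fun σ w => α σ q w t)
      ?_ (fun σ => ?_) (fun w => hsolve ν q w t) (fun σ => ?_)
    · have h : Differentiable ℝ fun v : Fin (m + k) → ℝ => (q, v, t) := by fun_prop
      exact (((hg ν).differentiable one_ne_zero).comp h).differentiableAt
    · have h : Differentiable ℝ fun w : Fin m → ℝ => (q, w, t) := by fun_prop
      exact (((hα σ).differentiable one_ne_zero).comp h).differentiableAt
    · rw [← sum_pd_mul]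
      exact hbar σ q u t
  simp_rw [Finset.sum_mul, mul_assoc]
  rw [Finset.sum_comm]
  simp_rw [← Finset.mul_sum, hpower, mul_zero, Finset.sum_const_zero]
end

section
/- Let L(q, q̇, t) be a continuously differentiable Lagrangian and define the restricted Lagrangian L*(q, q̇₁, …, q̇_m, t) := L(q, q̇₁, …, q̇_m, α₁, …, α_k, t). Define E := Σ_{j=1}^{n} q̇_j (∂L/∂q̇_j) − L evaluated at the constrained velocity q̇_{m+ν} = α_ν, and E* := Σ_{r=1}^{m} q̇_r (∂L*/∂q̇_r) − L*. Then E* = E + Σ_{ν=1}^{k} (ᾱ_ν − α_ν)(∂L/∂q̇_{m+ν}), where ᾱ_ν := Σ_{r=1}^{m} (∂α_ν/∂q̇_r) q̇_r. In particular, if ᾱ_ν = α_ν for every ν then E* = E. -/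
/-- Chain rule for partial derivatives. -/
theorem pd_comp {ι κ : Type*} [Fintype ι] [DecidableEq ι] [Fintype κ] [DecidableEq κ]
    {F : (ι → ℝ) → ℝ} {G : (κ → ℝ) → ι → ℝ} {x : κ → ℝ}
    (hF : DifferentiableAt ℝ F (G x)) (hG : ∀ j, DifferentiableAt ℝ (fun y => G y j) x) (r : κ) :
    pd (fun y => F (G y)) x r = ∑ j, pd (fun y => G y j) x r * pd F (G x) j := by
  have hcomp := hF.hasFDerivAt.comp x (hasFDerivAt_pi.2 fun j => (hG j).hasFDerivAt)
  simp only [pd]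
  rw [show (fun y => F (G y)) = F ∘ fun y j => G y j from rfl, hcomp.fderiv,
    ContinuousLinearMap.comp_apply]
  refine ((fderiv ℝ F (G x)).toLinearMap.pi_apply_eq_sum_univ _).trans
    (Finset.sum_congr rfl fun j _ => ?_)
  simp only [ContinuousLinearMap.coe_pi, smul_eq_mul, ContinuousLinearMap.coe_coe]
  congr 2
  ext i
  simp [Pi.single_apply, eq_comm]

theorem pd_coord {ι : Type*} [Fintype ι] [DecidableEq ι] (x : ι → ℝ) (i r : ι) :
    pd (fun y : ι → ℝ => y i) x r = if i = r then 1 else 0 := by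
  simp [pd, (hasFDerivAt_apply (𝕜 := ℝ) i x).fderiv, Pi.single_apply]

/-- Partial derivatives of a function restricted to the graph of `β`. -/
theorem pd_comp_append {m k : ℕ} {F : (Fin (m + k) → ℝ) → ℝ} {β : Fin k → (Fin m → ℝ) → ℝ}
    {u : Fin m → ℝ} (hF : DifferentiableAt ℝ F (Fin.append u fun σ => β σ u))
    (hβ : ∀ ν, DifferentiableAt ℝ (β ν) u) (r : Fin m) :
    pd (fun u' => F (Fin.append u' fun σ => β σ u')) u r
      = pd F (Fin.append u fun σ => β σ u) (Fin.castAdd k r)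
        + ∑ ν, pd (β ν) u r * pd F (Fin.append u fun σ => β σ u) (Fin.natAdd m ν) := by
  rw [pd_comp (G := fun u' => Fin.append u' fun σ => β σ u') hF, Fin.sum_univ_add]
  · simp [Fin.append_left, Fin.append_right, pd_coord]
  · intro j
    refine Fin.addCases (fun i => ?_) (fun ν => ?_) j
    · simp only [Fin.append_left]
      fun_prop
    · simpa only [Fin.append_right] using hβ ν

/-- with `L*` the restricted Lagrangian,
`E = Σ_j q̇_j (∂L/∂q̇_j) − L` (at the constrained velocity) and
`E* = Σ_r q̇_r (∂L*/∂q̇_r) − L*`, one has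
`E* = E + Σ_ν (ᾱ_ν − α_ν) ∂L/∂q̇_{m+ν}`; in particular if `ᾱ_ν = α_ν` for every `ν`
then `E* = E`. -/
theorem energy_relation (m k : ℕ) (hm : 0 < m) (hk : 0 < k)
    (g : Fin k → (Fin (m + k) → ℝ) → (Fin (m + k) → ℝ) → ℝ → ℝ)
    (hg : ∀ ν, ContDiff ℝ 1
      (fun p : ((Fin (m + k) → ℝ) × (Fin (m + k) → ℝ) × ℝ) => g ν p.1 p.2.1 p.2.2))
    (α : Fin k → (Fin (m + k) → ℝ) → (Fin m → ℝ) → ℝ → ℝ)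
    (hα : ∀ ν, ContDiff ℝ 1
      (fun p : ((Fin (m + k) → ℝ) × (Fin m → ℝ) × ℝ) => α ν p.1 p.2.1 p.2.2))
    (hdet : ∀ (q : Fin (m + k) → ℝ) (u : Fin m → ℝ) (t : ℝ),
      (Matrix.of fun ν s : Fin k =>
        pd (fun v => g ν q v t) (Fin.append u fun σ => α σ q u t) (Fin.natAdd m s)).det ≠ 0)
    (hsolve : ∀ (ν : Fin k) (q : Fin (m + k) → ℝ) (u : Fin m → ℝ) (t : ℝ),
      g ν q (Fin.append u fun σ => α σ q u t) t = 0)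
    (L : (Fin (m + k) → ℝ) → (Fin (m + k) → ℝ) → ℝ → ℝ)
    (hL : ContDiff ℝ 1
      (fun p : ((Fin (m + k) → ℝ) × (Fin (m + k) → ℝ) × ℝ) => L p.1 p.2.1 p.2.2)) :
    ∀ (q : Fin (m + k) → ℝ) (u : Fin m → ℝ) (t : ℝ),
      -- E* = E + Σ_ν (ᾱ_ν − α_ν) ∂L/∂q̇_{m+ν}
      ((∑ r : Fin m, u r *
            pd (fun u' : Fin m → ℝ => L q (Fin.append u' fun σ => α σ q u' t) t) u r)
          - L q (Fin.append u fun σ => α σ q u t) t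
        = ((∑ j, (Fin.append u fun σ => α σ q u t) j *
              pd (fun v => L q v t) (Fin.append u fun σ => α σ q u t) j)
            - L q (Fin.append u fun σ => α σ q u t) t)
          + ∑ ν : Fin k,
              ((∑ r : Fin m, pd (fun u' => α ν q u' t) u r * u r) - α ν q u t)
                * pd (fun v => L q v t) (Fin.append u fun σ => α σ q u t) (Fin.natAdd m ν))
      ∧ ((∀ ν : Fin k, ∑ r : Fin m, pd (fun u' => α ν q u' t) u r * u r = α ν q u t) →
          (∑ r : Fin m, u r *
              pd (fun u' : Fin m → ℝ => L q (Fin.append u' fun σ => α σ q u' t) t) u r)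
            - L q (Fin.append u fun σ => α σ q u t) t
          = (∑ j, (Fin.append u fun σ => α σ q u t) j *
                pd (fun v => L q v t) (Fin.append u fun σ => α σ q u t) j)
              - L q (Fin.append u fun σ => α σ q u t) t) := by
  intro q u t
  have hLd : Differentiable ℝ fun v => L q v t :=
    (hL.differentiable one_ne_zero).comp
      (f := fun v : Fin (m + k) → ℝ => (q, v, t)) (by fun_prop)
  have hαd : ∀ ν, Differentiable ℝ fun u' => α ν q u' t := fun ν =>
    ((hα ν).differentiable one_ne_zero).comp
      (f := fun u' : Fin m → ℝ => (q, u', t)) (by fun_prop)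
  refine and_iff_left_of_imp (fun h hbar => ?_) |>.2 ?_
  · rw [h]
    simp [hbar]
  · have hpd := pd_comp_append (β := fun ν u' => α ν q u' t) (hLd _) fun ν => hαd ν u
    simp only [hpd, Fin.sum_univ_add, Fin.append_left, Fin.append_right, mul_add,
      Finset.sum_add_distrib, sub_mul, Finset.sum_sub_distrib, Finset.mul_sum, Finset.sum_mul]
    rw [Finset.sum_comm (s := (Finset.univ : Finset (Fin m)))]
    simp only [mul_left_comm (u _), ← mul_assoc]
    ring
end
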